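/- Let p be a nonzero real number and let W : ℤ → ℝ satisfy W(n) = p·W(n−1) + W(n−2) for all n ∈ ℤ. Set e_W = p·W(0)·W(1) + W(0)² − W(1)² and γ_W = e_W·(p² − 1). Then for every integer k: (W(k−1)+W(k−3))·W(k−1)·W(k+1)·W(k+2) + W(k−2)·(W(k)+W(k−2))·W(k+1)·W(k+2) + W(k−2)·W(k−1)·(W(k)+W(k+2))·W(k+2) + W(k−2)·W(k−1)·W(k+1)·(W(k+3)+W(k+1)) = 2·W(k)·(W(k+1)+W(k−1))·(2·W(k)² + (−1)^k·γ_W). -/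

import Mathlib

/-- The characteristic of a generalized Fibonacci sequence alternates in sign along the sequence. -/
theorem characteristic_shift (p : ℝ) (W : ℤ → ℝ)
    (hW : ∀ n : ℤ, W n = p * W (n - 1) + W (n - 2)) (k : ℤ) :
    p * W k * W (k + 1) + W k ^ 2 - W (k + 1) ^ 2 =
      (-1 : ℝ) ^ k * (p * W 0 * W 1 + W 0 ^ 2 - W 1 ^ 2) := by
  have step (n : ℤ) : p * W (n + 1) * W (n + 2) + W (n + 1) ^ 2 - W (n + 2) ^ 2 =
      -(p * W n * W (n + 1) + W n ^ 2 - W (n + 1) ^ 2) := by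
    have h := hW (n + 2)
    rw [show n + 2 - 1 = n + 1 by ring, show n + 2 - 2 = n by ring] at h
    rw [h]
    ring
  induction k using Int.induction_on with
  | zero => simp
  | succ i ih =>
    rw [show (i : ℤ) + 1 + 1 = i + 2 by ring, step, ih, zpow_add_one₀ (by norm_num)]
    ring
  | pred i ih =>
    have h := step (-(i : ℤ) - 1)
    rw [show -(i : ℤ) - 1 + 2 = -i + 1 by ring, sub_add_cancel, ih] at h
    rw [sub_add_cancel, zpow_sub_one₀ (by norm_num)]
    linear_combination h

/-- an identity for generalized Fibonacci sequences derived from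
the generalized Gelin–Cesàro identity. -/
theorem statement11 (p : ℝ) (hp : p ≠ 0)
    (W : ℤ → ℝ) (hW : ∀ n : ℤ, W n = p * W (n - 1) + W (n - 2))
    (eW γW : ℝ)
    (heW : eW = p * W 0 * W 1 + W 0 ^ 2 - W 1 ^ 2)
    (hγW : γW = eW * (p ^ 2 - 1))
    (k : ℤ) :
    (W (k - 1) + W (k - 3)) * W (k - 1) * W (k + 1) * W (k + 2)
      + W (k - 2) * (W k + W (k - 2)) * W (k + 1) * W (k + 2)
      + W (k - 2) * W (k - 1) * (W k + W (k + 2)) * W (k + 2)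
      + W (k - 2) * W (k - 1) * W (k + 1) * (W (k + 3) + W (k + 1)) =
    2 * W k * (W (k + 1) + W (k - 1)) * (2 * W k ^ 2 + (-1 : ℝ) ^ k * γW) := by
  have hk := characteristic_shift p W hW k
  rw [← heW] at hk
  have h3 := hW (k + 3)
  have h2 := hW (k + 2)
  have h1 := hW (k + 1)
  have h0 := hW k
  have hm := hW (k - 1)
  rw [show k + 3 - 1 = k + 2 by ring, show k + 3 - 2 = k + 1 by ring] at h3
  rw [show k + 2 - 1 = k + 1 by ring, show k + 2 - 2 = k by ring] at h2
  rw [show k + 1 - 1 = k by ring, show k + 1 - 2 = k - 1 by ring] at h1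
  rw [show k - 1 - 1 = k - 2 by ring, show k - 1 - 2 = k - 3 by ring] at hm
  have e1 : W (k - 1) = W (k + 1) - p * W k := by linear_combination -h1
  have e2 : W (k - 2) = W k - p * W (k - 1) := by linear_combination -h0
  have e3 : W (k - 3) = W (k - 1) - p * W (k - 2) := by linear_combination -hm
  rw [hγW, ← mul_assoc, ← hk, h3, h2, e3, e2, e1]
  ring
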